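/- For every odd integer L ≥ 5, the subset of the braid group B_5 consisting of all products of rotated factor lists, namely { (G(a,b,c).rotate i).prod : a, b, c ≥ 0, a + b + c = (L − 5)/2, 0 ≤ i < L }, has at least L · choose((L−1)/2, 2) elements. -/

import Mathlib

/-- The Artin relations for the braid group with `n` generators
`σ_1, …, σ_n` (indexed by `Fin n` via `σ_{i+1} ↔ i`). -/
def braidRels (n : ℕ) : Set (FreeGroup (Fin n)) :=
  { r | ∃ i j : Fin n,
      ((i : ℕ) + 1 = (j : ℕ) ∧
        r = FreeGroup.of i * FreeGroup.of j * FreeGroup.of i *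
            (FreeGroup.of j * FreeGroup.of i * FreeGroup.of j)⁻¹) ∨
      ((i : ℕ) + 2 ≤ (j : ℕ) ∧
        r = FreeGroup.of i * FreeGroup.of j * (FreeGroup.of j * FreeGroup.of i)⁻¹) }

/-- The braid group `B_5`, presented with generators `σ_1, …, σ_4` and the Artin
relations. -/
abbrev B5 : Type := PresentedGroup (braidRels 4)

/-- The Artin generator `σ_{i+1}` of `B_5` (so `s 0 = σ_1`, …, `s 3 = σ_4`). -/
def s (i : Fin 4) : B5 := PresentedGroup.of i

/-- The list of `L = 5 + 2(a+b+c)` Garside factors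
`[σ1σ2σ3σ2σ4, σ2σ4σ3σ2σ1] ++ (a copies of the pair σ1σ2σ3σ2, σ2σ3σ2σ1) ++ [σ1σ3] ++
(b copies of the pair) ++ [σ1σ2σ3σ2σ1, σ1σ2σ3σ2σ1] ++ (c copies of the pair)` in `B_5`. -/
def G (a b c : ℕ) : List B5 :=
  [s 0 * s 1 * s 2 * s 1 * s 3, s 1 * s 3 * s 2 * s 1 * s 0] ++
    (List.replicate a [s 0 * s 1 * s 2 * s 1, s 1 * s 2 * s 1 * s 0]).flatten ++
    [s 0 * s 2] ++
    (List.replicate b [s 0 * s 1 * s 2 * s 1, s 1 * s 2 * s 1 * s 0]).flatten ++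
    [s 0 * s 1 * s 2 * s 1 * s 0, s 0 * s 1 * s 2 * s 1 * s 0] ++
    (List.replicate c [s 0 * s 1 * s 2 * s 1, s 1 * s 2 * s 1 * s 0]).flatten

def lkAct {R : Type} [CommRing R] (q t : R) (i : Fin 4) (x : Fin 10 → R) : Fin 10 → R :=
  match i with
  | 0 => ![t * q^2 * x 0 + t * q * (q - 1) * x 1 + t * q * (q - 1) * x 2 + t * q * (q - 1) * x 3, x 4, x 5,
      x 6, q * x 1 + (1 - q) * x 4, q * x 2 + (1 - q) * x 5,
      q * x 3 + (1 - q) * x 6, x 7, x 8,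
      x 9]
  | 1 => ![(1 - q) * x 0 + x 1, q * x 0, x 2,
      x 3, t * q^2 * (q - 1) * x 1 + t * q^1 * (q - 1)^2 * x 2 + t * q^1 * (q - 1)^2 * x 3 + t * q^2 * x 4 + t * q * (q - 1) * x 5 + t * q * (q - 1) * x 6, x 7,
      x 8, q * x 5 + (1 - q) * x 7, q * x 6 + (1 - q) * x 8,
      x 9]
  | 2 => ![x 0, (1 - q) * x 1 + x 2, q * x 1,
      x 3, (1 - q) * x 4 + x 5, q * x 4,
      x 6, t * q^3 * (q - 1) * x 2 + t * q^2 * (q - 1)^2 * x 3 + t * q^2 * (q - 1) * x 5 + t * q^1 * (q - 1)^2 * x 6 + t * q^2 * x 7 + t * q * (q - 1) * x 8, x 9,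
      q * x 8 + (1 - q) * x 9]
  | 3 => ![x 0, x 1, (1 - q) * x 2 + x 3,
      q * x 2, x 4, (1 - q) * x 5 + x 6,
      q * x 5, (1 - q) * x 7 + x 8, q * x 7,
      t * q^4 * (q - 1) * x 3 + t * q^3 * (q - 1) * x 6 + t * q^2 * (q - 1) * x 8 + t * q^2 * x 9]

def lkInv {K : Type} [Field K] (t : K) (i : Fin 4) (x : Fin 10 → K) : Fin 10 → K :=
  match i with
  | 0 => ![(4) * t⁻¹ * x 0 + (-1) * x 1 + (-1) * x 2 + (-1) * x 3 + (2) * x 4 + (2) * x 5 + (2) * x 6, (-1) * x 1 + (2) * x 4, (-1) * x 2 + (2) * x 5,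
      (-1) * x 3 + (2) * x 6, x 1, x 2,
      x 3, x 7, x 8,
      x 9]
  | 1 => ![(2) * x 1, x 0 + (-1) * x 1, x 2,
      x 3, (1/2) * x 0 + (-1/2) * x 1 + (-1/2) * x 2 + (-1/2) * x 3 + (4) * t⁻¹ * x 4 + (-1) * x 5 + (-1) * x 6 + (2) * x 7 + (2) * x 8, (-1) * x 5 + (2) * x 7,
      (-1) * x 6 + (2) * x 8, x 5, x 6,
      x 9]
  | 2 => ![x 0, (2) * x 2, x 1 + (-1) * x 2,
      x 3, (2) * x 5, x 4 + (-1) * x 5,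
      x 6, (1/4) * x 1 + (-1/4) * x 2 + (-1/4) * x 3 + (1/2) * x 4 + (-1/2) * x 5 + (-1/2) * x 6 + (4) * t⁻¹ * x 7 + (-1) * x 8 + (2) * x 9, (-1) * x 8 + (2) * x 9,
      x 8]
  | 3 => ![x 0, x 1, (2) * x 3,
      x 2 + (-1) * x 3, x 4, (2) * x 6,
      x 5 + (-1) * x 6, (2) * x 8, x 7 + (-1) * x 8,
      (1/8) * x 2 + (-1/8) * x 3 + (1/4) * x 5 + (-1/4) * x 6 + (1/2) * x 7 + (-1/2) * x 8 + (4) * t⁻¹ * x 9]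

def lkBool (i : Fin 4) (P : Fin 10 → Bool) : Fin 10 → Bool :=
  match i with
  | 0 => ![false, P 4, P 5,
      P 6, P 1 || P 4, P 2 || P 5,
      P 3 || P 6, P 7, P 8,
      P 9]
  | 1 => ![P 0 || P 1, P 0, P 2,
      P 3, false, P 7,
      P 8, P 5 || P 7, P 6 || P 8,
      P 9]
  | 2 => ![P 0, P 1 || P 2, P 1,
      P 3, P 4 || P 5, P 4,
      P 6, false, P 9,
      P 8 || P 9]
  | 3 => ![P 0, P 1, P 2 || P 3,
      P 2, P 4, P 5 || P 6,
      P 5, P 7 || P 8, P 7,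
      false]

theorem lk_braid {R : Type} [CommRing R] (q t : R) (i j : Fin 4) (h : (i : ℕ) + 1 = j)
    (x : Fin 10 → R) :
    lkAct q t i (lkAct q t j (lkAct q t i x)) = lkAct q t j (lkAct q t i (lkAct q t j x)) := by
  fin_cases i <;> fin_cases j <;> simp at h <;>
  · funext k
    fin_cases k <;> simp [lkAct] <;> ring

theorem lk_comm {R : Type} [CommRing R] (q t : R) (i j : Fin 4) (h : (i : ℕ) + 2 ≤ j)
    (x : Fin 10 → R) :
    lkAct q t i (lkAct q t j x) = lkAct q t j (lkAct q t i x) := by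
  fin_cases i <;> fin_cases j <;> simp at h <;>
  · funext k
    fin_cases k <;> simp [lkAct] <;> ring

theorem lk_inv_left {K : Type} [Field K] [CharZero K] (t : K) (ht : t ≠ 0) (i : Fin 4)
    (x : Fin 10 → K) : lkInv t i (lkAct 2⁻¹ t i x) = x := by
  fin_cases i <;>
  · funext k
    fin_cases k <;> simp [lkAct, lkInv] <;> field_simp <;> ring

theorem lk_inv_right {K : Type} [Field K] [CharZero K] (t : K) (ht : t ≠ 0) (i : Fin 4)
    (x : Fin 10 → K) : lkAct 2⁻¹ t i (lkInv t i x) = x := by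
  fin_cases i <;>
  · funext k
    fin_cases k <;> simp [lkAct, lkInv] <;> field_simp <;> ring

theorem lk_map {R S : Type} [CommRing R] [CommRing S] (f : R →+* S) (q t : R) (i : Fin 4)
    (x : Fin 10 → R) :
    (fun k => f (lkAct q t i x k)) = lkAct (f q) (f t) i (fun k => f (x k)) := by
  fin_cases i <;>
  · funext k
    fin_cases k <;> simp [lkAct]

/-- `u` is nonnegative with support exactly `P`. -/
def HasPat (P : Fin 10 → Bool) (u : Fin 10 → ℚ) : Prop :=
  ∀ k, 0 ≤ u k ∧ (P k = true ↔ 0 < u k)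

theorem pat_half {a : ℚ} {p : Bool} (h : 0 ≤ a ∧ (p = true ↔ 0 < a)) :
    0 ≤ 2⁻¹ * a ∧ (p = true ↔ 0 < 2⁻¹ * a) := by
  rw [h.2]; constructor
  · linarith [h.1]
  · constructor <;> intro <;> linarith

theorem pat_add {a b : ℚ} {p r : Bool} (h : 0 ≤ a ∧ (p = true ↔ 0 < a))
    (h' : 0 ≤ b ∧ (r = true ↔ 0 < b)) :
    0 ≤ a + b ∧ ((p || r) = true ↔ 0 < a + b) := by
  rw [Bool.or_eq_true, h.2, h'.2]
  obtain ⟨h1, -⟩ := h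
  obtain ⟨h2, -⟩ := h'
  refine ⟨by linarith, ?_, ?_⟩
  · rintro (h | h) <;> linarith
  · intro h
    by_contra! hc
    linarith [hc.1, hc.2]

set_option maxHeartbeats 1000000 in
theorem lk_pat (i : Fin 4) (P : Fin 10 → Bool) (u : Fin 10 → ℚ) (h : HasPat P u) :
    HasPat (lkBool i P) (lkAct 2⁻¹ 0 i u) := by
  have e : (1 - 2⁻¹ : ℚ) = 2⁻¹ := by norm_num
  have e' : ∀ y : ℚ, (1 - 2⁻¹) * y = 2⁻¹ * y := by rw [e]; simp
  intro k
  fin_cases i <;> fin_cases k <;> simp [lkAct, lkBool, -Bool.or_eq_true, e'] <;>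
    first
    | exact h _
    | exact pat_half (h _)
    | exact pat_add (pat_half (h _)) (h _)
    | exact pat_add (pat_half (h _)) (pat_half (h _))
    | exact pat_add (h _) (pat_half (h _))

noncomputable section

/-- The generator as a permutation of the vectors. -/
def lkPerm (i : Fin 4) : Equiv.Perm (Fin 10 → RatFunc ℚ) where
  toFun := lkAct 2⁻¹ RatFunc.X i
  invFun := lkInv RatFunc.X i
  left_inv := lk_inv_left _ RatFunc.X_ne_zero i
  right_inv := lk_inv_right _ RatFunc.X_ne_zero i

/-- The representation. -/
def lkRep : B5 →* Equiv.Perm (Fin 10 → RatFunc ℚ) :=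
  PresentedGroup.toGroup (f := lkPerm) (by
    rintro r ⟨i, j, ⟨h, rfl⟩ | ⟨h, rfl⟩⟩
    · simp only [map_mul, map_inv, FreeGroup.lift_apply_of]
      rw [mul_inv_eq_one]
      ext1 x
      exact lk_braid _ _ i j h x
    · simp only [map_mul, map_inv, FreeGroup.lift_apply_of]
      rw [mul_inv_eq_one]
      ext1 x
      exact lk_comm _ _ i j h x)

theorem lkRep_s (i : Fin 4) (x : Fin 10 → RatFunc ℚ) :
    lkRep (s i) x = lkAct 2⁻¹ RatFunc.X i x := by
  unfold lkRep s
  rw [PresentedGroup.toGroup.of]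
  rfl

/-- The cone of vectors with support pattern `P` modulo `X`. -/
def Cone (P : Fin 10 → Bool) (v : Fin 10 → RatFunc ℚ) : Prop :=
  ∃ w : Fin 10 → Polynomial ℚ, (v = fun k => algebraMap _ _ (w k)) ∧
    HasPat P (fun k => Polynomial.evalRingHom 0 (w k))

theorem cone_unique {P Q : Fin 10 → Bool} {v} (h : Cone P v) (h' : Cone Q v) : P = Q := by
  obtain ⟨w, rfl, hw⟩ := h
  obtain ⟨w', e, hw'⟩ := h'
  have : w = w' := by
    funext k
    exact RatFunc.algebraMap_injective ℚ (congrFun e k)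
  subst this
  funext k
  rw [Bool.eq_iff_iff, (hw k).2, (hw' k).2]

theorem cone_s (i : Fin 4) {P : Fin 10 → Bool} {v} (h : Cone P v) :
    Cone (lkBool i P) (lkRep (s i) v) := by
  obtain ⟨w, rfl, hw⟩ := h
  refine ⟨lkAct (Polynomial.C 2⁻¹) Polynomial.X i w, ?_, ?_⟩
  · rw [lk_map, lkRep_s]
    congr 1
    rw [RatFunc.algebraMap_C, map_inv₀, map_ofNat]
  · rw [lk_map]
    have := lk_pat i _ _ hw
    simpa using this

/-- Letters as words in the generators. -/
def wd : Fin 6 → List (Fin 4) :=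
  ![[0, 1, 2, 1, 3], [1, 3, 2, 1, 0], [0, 1, 2, 1], [1, 2, 1, 0], [0, 2], [0, 1, 2, 1, 0]]

def stt : Fin 6 → Fin 3 := ![0, 1, 0, 2, 0, 0]

def ent : Fin 6 → Fin 3 := ![1, 0, 2, 0, 0, 0]

def pat : Fin 6 → Fin 10 → Bool :=
  ![![false, false, false, false, true, true, true, false, true, true],
    ![true, true, true, false, false, true, false, true, false, false],
    ![false, false, false, true, true, true, true, false, true, true],
    ![true, true, false, true, false, false, true, false, true, true],
    ![false, true, true, true, true, true, true, false, true, true],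
    ![false, false, false, true, true, false, true, false, true, true]]

def pat0 : Fin 10 → Bool :=
  ![true, false, true, false, true, false, true, true, false, true]

/-- Value of a letter. -/
def vl (x : Fin 6) : B5 := ((wd x).map s).prod

theorem cone_word (l : List (Fin 4)) {P : Fin 10 → Bool} {v} (h : Cone P v) :
    Cone (l.foldr lkBool P) (lkRep (l.map s).prod v) := by
  induction l with
  | nil => simpa using h
  | cons i l ih =>
    simp only [List.map_cons, List.prod_cons, map_mul, List.foldr_cons]
    exact cone_s i ih

theorem pat_inj : ∀ x y, pat x = pat y → x = y := by decide

theorem pat_base : ∀ x, (wd x).foldr lkBool pat0 = pat x := by decide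

theorem pat_step : ∀ x y, ent x = stt y → (wd x).foldr lkBool (pat y) = pat x := by decide

def GPath : Fin 3 → List (Fin 6) → Fin 3 → Prop
  | a, [], b => a = b
  | a, x :: l, b => stt x = a ∧ GPath (ent x) l b

theorem path_append (l l' : List (Fin 6)) (a c : Fin 3) :
    GPath a (l ++ l') c ↔ ∃ b, GPath a l b ∧ GPath b l' c := by
  induction l generalizing a with
  | nil => simp [GPath]
  | cons x l ih => simp [GPath, ih, and_assoc]

theorem exists_base : ∃ v, Cone pat0 v := by
  refine ⟨_, fun k => if pat0 k then 1 else 0, rfl, ?_⟩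
  intro k
  by_cases h : pat0 k <;> simp [h]

theorem cone_path {v} (hv : Cone pat0 v) (l : List (Fin 6)) : ∀ (x : Fin 6) (a b : Fin 3),
    GPath a (x :: l) b → Cone (pat x) (lkRep ((x :: l).map vl).prod v) := by
  induction l with
  | nil =>
    intro x a b _
    rw [← pat_base]
    simpa [vl] using cone_word (wd x) hv
  | cons y l ih =>
    intro x a b h
    have h1 := ih y _ _ h.2
    have h2 := cone_word (wd x) h1
    rw [pat_step x y h.2.1.symm] at h2
    rw [List.map_cons, List.prod_cons, map_mul]
    exact h2

theorem path_inj {v} (hv : Cone pat0 v) (l : List (Fin 6)) : ∀ (l' : List (Fin 6))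
    (a b a' b' : Fin 3), GPath a l b → GPath a' l' b' → l.length = l'.length →
    (l.map vl).prod = (l'.map vl).prod → l = l' := by
  induction l with
  | nil =>
    intro l' _ _ _ _ _ _ h _
    exact (List.length_eq_zero_iff.1 h.symm).symm
  | cons x l ih =>
    intro l' a b a' b' h h' hl hp
    cases l' with
    | nil => simp at hl
    | cons y l' =>
      have h1 := cone_path hv l x a b h
      have h2 := cone_path hv l' y a' b' h'
      rw [hp] at h1
      obtain rfl := pat_inj _ _ (cone_unique h1 h2)
      simp only [List.map_cons, List.prod_cons, mul_right_inj] at hp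
      rw [ih l' _ _ _ _ h.2 h'.2 (by simpa using hl) hp]

/-- Letter version of `G`. -/
def Gw (a b c : ℕ) : List (Fin 6) :=
  [0, 1] ++ (List.replicate a [2, 3]).flatten ++ [4] ++ (List.replicate b [2, 3]).flatten ++
    [5, 5] ++ (List.replicate c [2, 3]).flatten

theorem G_eq (a b c : ℕ) : G a b c = (Gw a b c).map vl := by
  simp [G, Gw, vl, wd, List.map_flatten, List.map_replicate, mul_assoc]

theorem Gw_length (a b c : ℕ) : (Gw a b c).length = 5 + 2 * (a + b + c) := by
  simp [Gw]; ring

theorem path_rep (n : ℕ) : GPath 0 (List.replicate n [2, 3]).flatten 0 := by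
  induction n with
  | zero => simp [GPath]
  | succ n ih =>
    rw [List.replicate_succ, List.flatten_cons, path_append]
    exact ⟨0, by simp [GPath, stt, ent], ih⟩

theorem Gw_path (a b c : ℕ) : GPath 0 (Gw a b c) 0 := by
  unfold Gw
  simp only [path_append]
  exact ⟨0, ⟨0, ⟨0, ⟨0, ⟨0, by simp [GPath, stt, ent], path_rep a⟩, by simp [GPath, stt, ent]⟩,
    path_rep b⟩, by simp [GPath, stt, ent]⟩, path_rep c⟩

theorem Gw_rot_path (a b c i : ℕ) (hi : i ≤ (Gw a b c).length) :
    ∃ m, GPath m ((Gw a b c).rotate i) m := by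
  have h := Gw_path a b c
  rw [← List.take_append_drop i (Gw a b c), path_append] at h
  obtain ⟨m, h1, h2⟩ := h
  refine ⟨m, ?_⟩
  rw [List.rotate_eq_drop_append_take hi, path_append]
  exact ⟨0, h2, h1⟩

theorem not_mem_rep (x : Fin 6) (h2 : x ≠ 2) (h3 : x ≠ 3) (n : ℕ) :
    x ∉ (List.replicate n [(2 : Fin 6), 3]).flatten := by
  simp [List.mem_flatten, List.mem_replicate, h2, h3]

theorem Gw_idx4 (a b c : ℕ) : (Gw a b c).idxOf 4 = 2 + 2 * a := by
  have h := not_mem_rep 4 (by decide) (by decide) a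
  unfold Gw
  simp only [List.append_assoc]
  rw [List.idxOf_append_of_notMem (by decide), List.idxOf_append_of_notMem h]
  simp; ring

theorem Gw_idx5 (a b c : ℕ) : (Gw a b c).idxOf 5 = 3 + 2 * a + 2 * b := by
  have h := not_mem_rep 5 (by decide) (by decide)
  unfold Gw
  simp only [List.append_assoc]
  rw [List.idxOf_append_of_notMem (by decide), List.idxOf_append_of_notMem (h a),
    List.idxOf_append_of_notMem (by decide), List.idxOf_append_of_notMem (h b)]
  simp; ring

theorem Gw_head (a b c : ℕ) : ∃ tl, Gw a b c = 0 :: tl ∧ (0 : Fin 6) ∉ tl := by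
  have h := not_mem_rep 0 (by decide) (by decide)
  refine ⟨_, rfl, ?_⟩
  simp only [List.append_eq, List.nil_append, List.mem_append, List.mem_cons, h]
  decide

theorem rot_aux {l l' : List (Fin 6)} (h : ∃ tl, l = 0 :: tl ∧ (0 : Fin 6) ∉ tl)
    (h' : ∃ tl, l' = 0 :: tl ∧ (0 : Fin 6) ∉ tl) {i j : ℕ} (hi : i < l.length)
    (hj : j < l.length) (hl : l.length = l'.length) (e : l.rotate i = l'.rotate j) :
    i = j ∧ l = l' := by
  wlog hij : i ≤ j generalizing l l' i j
  · have := this h' h (hl ▸ hj) (hl ▸ hi) hl.symm e.symm (by omega)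
    exact ⟨this.1.symm, this.2.symm⟩
  obtain ⟨d, rfl⟩ := Nat.exists_eq_add_of_le hij
  rw [add_comm i d, ← List.rotate_rotate] at e
  have e1 : l = l'.rotate d := List.rotate_injective i e
  obtain ⟨tl, rfl, -⟩ := h
  obtain ⟨tl', rfl, h0⟩ := h'
  rcases Nat.eq_zero_or_pos d with rfl | hd
  · exact ⟨by simp, by simpa using e1⟩
  · exfalso
    obtain ⟨k, rfl⟩ : ∃ k, d = k + 1 := ⟨d - 1, by omega⟩
    have hk : k < tl'.length := by simp at hl hj; omega
    rw [List.rotate_eq_drop_append_take (by simp; omega), List.drop_succ_cons,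
      List.drop_eq_getElem_cons hk, List.cons_append] at e1
    have := (List.cons.inj e1).1
    exact h0 (this ▸ List.getElem_mem hk)

theorem main_inj {a b c i a' b' c' i' : ℕ} (hs : a + b + c = a' + b' + c')
    (hi : i < 5 + 2 * (a + b + c)) (hi' : i' < 5 + 2 * (a + b + c))
    (e : ((G a b c).rotate i).prod = ((G a' b' c').rotate i').prod) :
    a = a' ∧ b = b' ∧ c = c' ∧ i = i' := by
  obtain ⟨v, hv⟩ := exists_base
  have hl := Gw_length a b c
  have hl' := Gw_length a' b' c'
  rw [G_eq, G_eq, ← List.map_rotate, ← List.map_rotate] at e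
  obtain ⟨m, hm⟩ := Gw_rot_path a b c i (by omega)
  obtain ⟨m', hm'⟩ := Gw_rot_path a' b' c' i' (by omega)
  have e1 := path_inj hv _ _ _ _ _ _ hm hm' (by simp [hl, hl', hs]) e
  obtain ⟨h1, h2⟩ := rot_aux (Gw_head _ _ _) (Gw_head _ _ _) (by omega) (by omega)
    (by omega) e1
  have h4 := congrArg (List.idxOf 4) h2
  have h5 := congrArg (List.idxOf 5) h2
  rw [Gw_idx4, Gw_idx4] at h4
  rw [Gw_idx5, Gw_idx5] at h5
  omega

end

theorem card_rotated_products (L : ℕ) (hodd : Odd L) (hL : 5 ≤ L) :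
    L * Nat.choose ((L - 1) / 2) 2 ≤
      Set.ncard {x : B5 | ∃ a b c i : ℕ, a + b + c = (L - 5) / 2 ∧ i < L ∧
        x = ((G a b c).rotate i).prod} := by
  obtain ⟨m, rfl⟩ : ∃ m, L = 5 + 2 * m := by
    obtain ⟨k, rfl⟩ := hodd
    exact ⟨k - 2, by omega⟩
  have e1 : (5 + 2 * m - 5) / 2 = m := by omega
  have e2 : (5 + 2 * m - 1) / 2 = m + 2 := by omega
  rw [e1, e2]
  let D : Finset ((_ : ℕ) × ℕ) := (Finset.range (m + 1)).sigma (fun k => Finset.range (k + 1))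
  let E := D ×ˢ Finset.range (5 + 2 * m)
  let f : ((_ : ℕ) × ℕ) × ℕ → B5 := fun p =>
    ((G p.1.2 (p.1.1 - p.1.2) (m - p.1.1)).rotate p.2).prod
  have hD : D.card = (m + 2).choose 2 := by
    simp only [D, Finset.card_sigma, Finset.card_range]
    have := Finset.sum_range_succ' (fun k => k) (m + 1)
    simp only [add_zero] at this
    rw [← this, Finset.sum_range_id, Nat.choose_two_right]
  have hset : {x : B5 | ∃ a b c i : ℕ, a + b + c = m ∧ i < 5 + 2 * m ∧
        x = ((G a b c).rotate i).prod} = f '' (E : Set _) := by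
    ext x
    constructor
    · rintro ⟨a, b, c, i, h, hi, rfl⟩
      refine ⟨(⟨a + b, a⟩, i), ?_, ?_⟩
      · simp [E, D]; omega
      · have h1 : a + b - a = b := by omega
        have h2 : m - (a + b) = c := by omega
        simp only [f, h1, h2]
    · rintro ⟨⟨⟨k, a⟩, i⟩, h, rfl⟩
      simp [E, D] at h
      exact ⟨a, k - a, m - k, i, by omega, by omega, rfl⟩
  have hinj : Set.InjOn f (E : Set _) := by
    rintro ⟨⟨k, a⟩, i⟩ h ⟨⟨k', a'⟩, i'⟩ h' e
    simp [E, D] at h h'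
    change ((G a (k - a) (m - k)).rotate i).prod = ((G a' (k' - a') (m - k')).rotate i').prod at e
    obtain ⟨h1, h2, h3, h4⟩ := main_inj (by omega) (by omega) (by omega) e
    obtain rfl : k = k' := by omega
    subst h1 h4
    rfl
  rw [hset, hinj.ncard_image, Set.ncard_coe_finset]
  simp only [E, Finset.card_product, hD, Finset.card_range]
  rw [mul_comm]
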